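/- Let F : ℝⁿ → ℝᵐ be continuously differentiable with each gradient ∇Fᵢ Lipschitz continuous with constant L > 0, and let ψ(x,d) = max_{1≤i≤m} ⟨∇Fᵢ(x), d⟩. Fix x, d ∈ ℝⁿ with d ≠ 0 and ψ(x,d) < 0, and ρ ∈ (0,1). If a step size α > 0 violates the Armijo condition relative to the current value, i.e. there exists i ∈ {1,…,m} with Fᵢ(x + α d) > Fᵢ(x) + ρ α ψ(x,d), then α > (1 − ρ)(−ψ(x,d)) / (L ‖d‖²). -/

import Mathlib

open scoped RealInnerProductSpace

noncomputable def psi {n m : ℕ} [NeZero m]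
    (F : Fin m → EuclideanSpace ℝ (Fin n) → ℝ)
    (x d : EuclideanSpace ℝ (Fin n)) : ℝ :=
  Finset.univ.sup' Finset.univ_nonempty fun i => ⟪gradient (F i) x, d⟫

/-- First-order upper bound for a function with Lipschitz gradient, obtained from the mean value
theorem (the constant is not the optimal `K / 2`). -/
theorem image_add_le_of_lipschitzWith_gradient {E : Type*} [NormedAddCommGroup E]
    [InnerProductSpace ℝ E] [CompleteSpace E] {f : E → ℝ} (hf : Differentiable ℝ f)
    {K : NNReal} (hK : LipschitzWith K (gradient f)) (x v : E) :
    f (x + v) ≤ f x + ⟪gradient f x, v⟫ + K * ‖v‖ ^ 2 := by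
  have hderiv : ∀ t : ℝ, HasDerivAt (fun t : ℝ => f (x + t • v))
      ⟪gradient f (x + t • v), v⟫ t := by
    intro t
    have hline : HasDerivAt (fun t : ℝ => x + t • v) v t := by
      simpa using ((hasDerivAt_id t).smul_const v).const_add x
    exact (hf (x + t • v)).hasGradientAt.hasFDerivAt.comp_hasDerivAt t hline
  obtain ⟨c, ⟨hc0, hc1⟩, hc⟩ := exists_hasDerivAt_eq_slope (fun t : ℝ => f (x + t • v)) _
    zero_lt_one (fun t _ => (hderiv t).continuousAt.continuousWithinAt) (fun t _ => hderiv t)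
  simp only [one_smul, zero_smul, add_zero, sub_zero, div_one] at hc
  have hgrad : ‖gradient f (x + c • v) - gradient f x‖ ≤ K * ‖v‖ := by
    calc ‖gradient f (x + c • v) - gradient f x‖ ≤ K * ‖x + c • v - x‖ := hK.norm_sub_le _ _
      _ = K * (c * ‖v‖) := by rw [add_sub_cancel_left, norm_smul, Real.norm_of_nonneg hc0.le]
      _ ≤ K * ‖v‖ := by
        gcongr
        exact mul_le_of_le_one_left (norm_nonneg v) hc1.le
  have hinner : ⟪gradient f (x + c • v), v⟫ - ⟪gradient f x, v⟫ ≤ K * ‖v‖ ^ 2 := by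
    rw [← inner_sub_left]
    calc ⟪gradient f (x + c • v) - gradient f x, v⟫
        ≤ ‖gradient f (x + c • v) - gradient f x‖ * ‖v‖ := real_inner_le_norm _ _
      _ ≤ K * ‖v‖ * ‖v‖ := by gcongr
      _ = K * ‖v‖ ^ 2 := by ring
  linarith

theorem stmt13 {n m : ℕ} [NeZero m]
    (F : Fin m → EuclideanSpace ℝ (Fin n) → ℝ)
    (hF : ∀ i, ContDiff ℝ 1 (F i))
    (L : ℝ) (hL : 0 < L)
    (hLip : ∀ i, LipschitzWith L.toNNReal (fun y => gradient (F i) y))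
    (x d : EuclideanSpace ℝ (Fin n)) (hd : d ≠ 0) (hdesc : psi F x d < 0)
    (ρ : ℝ) (hρ : ρ ∈ Set.Ioo (0 : ℝ) 1)
    (α : ℝ) (hα : 0 < α)
    (hviol : ∃ i, F i (x + α • d) > F i x + ρ * α * psi F x d) :
    α > (1 - ρ) * (-psi F x d) / (L * ‖d‖ ^ 2) := by
  obtain ⟨i, hi⟩ := hviol
  have hbound := image_add_le_of_lipschitzWith_gradient
    ((hF i).differentiable one_ne_zero) (hLip i) x (α • d)
  rw [real_inner_smul_right, norm_smul, Real.norm_of_nonneg hα.le, Real.coe_toNNReal L hL.le]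
    at hbound
  have hpsi : ⟪gradient (F i) x, d⟫ ≤ psi F x d :=
    Finset.le_sup' (fun i => ⟪gradient (F i) x, d⟫) (Finset.mem_univ i)
  have hscaled := mul_le_mul_of_nonneg_left hpsi hα.le
  have hnorm : 0 < ‖d‖ := norm_pos_iff.mpr hd
  rw [gt_iff_lt, div_lt_iff₀ (by positivity)]
  refine lt_of_mul_lt_mul_left ?_ hα.le
  linarith
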